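/- Under the right-spinor Dirac setup, the energy-momentum tensor is trace-free: Σ_{μ=0}^{3} T_μ^μ = 0 on ℝ⁴. -/

import Mathlib

open Matrix

noncomputable section

/-- The space algebra `Cl(3)` represented as `M₂(ℂ)`. -/
abbrev M2 : Type := Matrix (Fin 2) (Fin 2) ℂ

/-- Spacetime `ℝ⁴`. -/
abbrev R4 : Type := Fin 4 → ℝ

/-- Basis paravectors: `e 0 = 1` and the Pauli matrices. -/
def e : Fin 4 → M2 :=
  ![1, !![0, 1; 1, 0], !![0, -Complex.I; Complex.I, 0], !![1, 0; 0, -1]]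

/-- Dual basis paravectors: `edual 0 = 1` and `edual k = - e k` for `k = 1,2,3`. -/
def edual : Fin 4 → M2 :=
  ![1, -e 1, -e 2, -e 3]

/-- The grade automorphism `M̂ = (adj M)†`. -/
def gradeAut (M : M2) : M2 := (M.adjugate)ᴴ

/-- The projector `P = ½(1+e₃)`. -/
def P : M2 := !![1, 0; 0, 0]

/-- The projector `P̄ = ½(1-e₃)`. -/
def Pbar : M2 := !![0, 0; 0, 1]

/-- Partial derivative `∂_μ` of a complex-valued function on `ℝ⁴`. -/
def pdC (μ : Fin 4) (f : R4 → ℂ) (x : R4) : ℂ := fderiv ℝ f x (Pi.single μ 1)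

/-- Partial derivative `∂_μ` of a real-valued function on `ℝ⁴`. -/
def pdR (μ : Fin 4) (f : R4 → ℝ) (x : R4) : ℝ := fderiv ℝ f x (Pi.single μ 1)

/-- Entrywise partial derivative `∂_μ` of an `M₂(ℂ)`-valued function on `ℝ⁴`. -/
def pdM (μ : Fin 4) (f : R4 → M2) (x : R4) : M2 :=
  Matrix.of fun i j => pdC μ (fun y => f y i j) x

/-- Components of the chiral current `𝔧 = φ·P̄·φ†`: `j^μ = ½ tr(𝔧 * e μ)`
(note `e 0 = 1`). -/
def jComp (φ : R4 → M2) (μ : Fin 4) (x : R4) : ℂ :=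
  (1/2) * (φ x * Pbar * (φ x)ᴴ * e μ).trace

/-- Tétrode's energy-momentum tensor `T_ν^μ`. -/
def TComp (Γ : Fin 4 → R4 → ℝ) (φ : R4 → M2) (ν μ : Fin 4) (x : R4) : ℂ :=
  -(Complex.I / 4) *
      (edual μ *
        (pdM ν (fun y => gradeAut (φ y)) x * P * (φ x).adjugate
          - gradeAut (φ x) * P * pdM ν (fun y => (φ y).adjugate) x)).trace
    + (Γ ν x : ℂ) * jComp φ μ x

/-- The Levi-Civita symbol on `{1,2,3}` (indexed by `Fin 3`), with `ε 0 1 2 = 1`. -/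
def eps : Fin 3 → Fin 3 → Fin 3 → ℝ := fun i j k =>
  if (i, j, k) = (0, 1, 2) ∨ (i, j, k) = (1, 2, 0) ∨ (i, j, k) = (2, 0, 1) then 1
  else if (i, j, k) = (2, 1, 0) ∨ (i, j, k) = (1, 0, 2) ∨ (i, j, k) = (0, 2, 1) then -1
  else 0

lemma pdC_conj (μ : Fin 4) (f : R4 → ℂ) (x : R4) :
    pdC μ (fun y => (starRingEnd ℂ) (f y)) x = (starRingEnd ℂ) (pdC μ f x) := by
  unfold pdC
  have h := Complex.conjCLE.comp_fderiv (f := f) (x := x)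
  have h2 : (fun y => (starRingEnd ℂ) (f y)) = Complex.conjCLE ∘ f := by
    ext y; simp
  rw [h2, h]; simp

lemma pdC_neg (μ : Fin 4) (f : R4 → ℂ) (x : R4) :
    pdC μ (fun y => - f y) x = - pdC μ f x := by
  unfold pdC
  rw [fderiv_fun_neg]; simp

lemma pdC_zero (μ : Fin 4) (x : R4) : pdC μ (fun _ => 0) x = 0 := by
  unfold pdC
  simp

/-- Tétrode's energy-momentum tensor is trace-free. -/
theorem energy_momentum_trace_free
    (Γ : Fin 4 → R4 → ℝ) (hΓ : ∀ μ, ContDiff ℝ (⊤ : ℕ∞) (Γ μ))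
    (φ : R4 → M2) (hφ : ∀ i j, ContDiff ℝ (⊤ : ℕ∞) (fun x => φ x i j))
    (hDirac : ∀ x : R4,
      (∑ μ : Fin 4, edual μ * pdM μ (fun y => gradeAut (φ y) * P) x)
        + Complex.I • ((∑ μ : Fin 4, (Γ μ x : ℂ) • edual μ) * (gradeAut (φ x) * P)) = 0) :
    ∀ x : R4, ∑ μ : Fin 4, TComp Γ φ μ μ x = 0 := by
  intro x
  have h := hDirac x
  have hp : ∀ y, gradeAut (φ y) * P =
      !![(starRingEnd ℂ) (φ y 1 1), 0; -(starRingEnd ℂ) (φ y 0 1), 0] := by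
    intro y
    ext i j; fin_cases i <;> fin_cases j <;>
      simp [gradeAut, P, Matrix.mul_apply, Fin.sum_univ_two, Matrix.adjugate_fin_two]
  have hd : ∀ μ, pdM μ (fun y => gradeAut (φ y) * P) x =
      !![(starRingEnd ℂ) (pdC μ (fun y => φ y 1 1) x), 0;
        -(starRingEnd ℂ) (pdC μ (fun y => φ y 0 1) x), 0] := by
    intro μ
    simp only [hp]
    ext i j; fin_cases i <;> fin_cases j <;>
      simp [pdM, pdC_conj, pdC_neg, pdC_zero]
  simp only [hd] at h
  simp only [hp] at h
  have h0 := congrFun (congrFun h 0) 0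
  have h1 := congrFun (congrFun h 1) 0
  have e0 : edual 0 = !![1, 0; 0, 1] := by
    ext i j; fin_cases i <;> fin_cases j <;> simp [edual]
  have e1 : edual 1 = !![0, -1; -1, 0] := by
    ext i j; fin_cases i <;> fin_cases j <;> simp [edual, e]
  have e2 : edual 2 = !![0, Complex.I; -Complex.I, 0] := by
    ext i j; fin_cases i <;> fin_cases j <;> simp [edual, e]
  have e3 : edual 3 = !![-1, 0; 0, 1] := by
    ext i j; fin_cases i <;> fin_cases j <;> simp [edual, e]
  simp [Fin.sum_univ_four, e0, e1, e2, e3, Matrix.mul_apply, Fin.sum_univ_two] at h0 h1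
  have c0 := congrArg (starRingEnd ℂ) h0
  have c1 := congrArg (starRingEnd ℂ) h1
  simp at c0 c1
  simp [TComp, jComp, Fin.sum_univ_four, e0, e1, e2, e3, pdM, gradeAut, P, Pbar, e,
    Matrix.mul_apply, Fin.sum_univ_two, Matrix.trace,
    Matrix.adjugate_fin_two, pdC_conj, pdC_neg]
  have hI := Complex.I_sq
  generalize (starRingEnd ℂ) (φ x 1 1) = ds at *
  generalize (starRingEnd ℂ) (φ x 0 1) = bs at *
  generalize φ x 1 1 = d at *
  generalize φ x 0 1 = b at *
  linear_combination -(Complex.I / 4) * (d * h0 - b * h1 - ds * c0 + bs * c1)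
    + (1 / 2) * ((Γ 0 x : ℂ) * (b * bs + d * ds) + (Γ 1 x : ℂ) * (b * ds + d * bs)
      + (Γ 2 x : ℂ) * Complex.I * (b * ds - d * bs) + (Γ 3 x : ℂ) * (b * bs - d * ds)) * hI
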